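/- Let G be a group with finite generating set S, and suppose G does not contain any finite-index subgroup that is nilpotent of class at most 2. Then for every n ∈ ℕ with n ≥ 1, the set of commutators C(S^{≤n}, S^{≤n}) = {[g, h] : g, h ∈ S^{≤n}} has cardinality at least n/2. -/

import Mathlib

open Pointwise
open scoped commutatorElement

/-- `S^{≤n}`: the set of elements expressible as a product of at most `n` elements
of `S ∪ S⁻¹`. -/
def ballSet {G : Type*} [Group G] (S : Set G) (n : ℕ) : Set G :=
  (insert (1 : G) (S ∪ S⁻¹)) ^ n

/-- The set of commutators `C(A, B) = {[g, h] : g ∈ A, h ∈ B}`. -/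
def commPairs {G : Type*} [Group G] (A B : Set G) : Set G :=
  {z : G | ∃ g ∈ A, ∃ h ∈ B, z = ⁅g, h⁆}

section

variable {G : Type*} [Group G]

lemma one_mem_symm (S : Set G) : (1 : G) ∈ insert (1 : G) (S ∪ S⁻¹) :=
  Set.mem_insert _ _

lemma ballSet_mono (S : Set G) : Monotone (ballSet S) :=
  fun _ _ hmn => Set.pow_subset_pow_right (one_mem_symm S) hmn

lemma subset_ballSet (S : Set G) {n : ℕ} (hn : 1 ≤ n) : S ⊆ ballSet S n := fun s hs =>
  ballSet_mono S hn (by simp [ballSet, hs])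

lemma finite_ballSet {S : Set G} (hS : S.Finite) (n : ℕ) : (ballSet S n).Finite := by
  induction n with
  | zero => simp [ballSet]
  | succ n ih =>
    rw [ballSet, pow_succ]
    exact ih.mul ((hS.union hS.inv).insert 1)

lemma conj_mem_ballSet {S : Set G} {n : ℕ} {s g : G} (hs : s ∈ S ∪ S⁻¹)
    (hg : g ∈ ballSet S n) : s * g * s⁻¹ ∈ ballSet S (n + 2) := by
  have hs' : s⁻¹ ∈ S ∪ S⁻¹ := by simpa [or_comm] using hs
  have h₁ : s * g ∈ ballSet S (n + 1) := by
    rw [ballSet, pow_succ']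
    exact Set.mul_mem_mul (Or.inr hs) hg
  rw [ballSet, pow_succ]
  exact Set.mul_mem_mul h₁ (Or.inr hs')

lemma commPairs_mono {A B : Set G} (h : A ⊆ B) : commPairs A A ⊆ commPairs B B := by
  rintro _ ⟨a, ha, b, hb, rfl⟩
  exact ⟨a, h ha, b, h hb, rfl⟩

lemma finite_commPairs {A B : Set G} (hA : A.Finite) (hB : B.Finite) :
    (commPairs A B).Finite := by
  refine (hA.image2 (fun g h => ⁅g, h⁆) hB).subset ?_
  rintro _ ⟨a, ha, b, hb, rfl⟩
  exact ⟨a, ha, b, hb, rfl⟩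

/-- If the commutators of the ball of radius `n` exhaust those of radius `n + 2`, then they form
a set invariant under conjugation. -/
lemma conj_mem_commPairs_iff {S : Set G} (hgen : Subgroup.closure S = ⊤) {n : ℕ}
    (h : commPairs (ballSet S (n + 2)) (ballSet S (n + 2)) ⊆
      commPairs (ballSet S n) (ballSet S n)) (x t : G) :
    MulAut.conj x t ∈ commPairs (ballSet S n) (ballSet S n) ↔
      t ∈ commPairs (ballSet S n) (ballSet S n) := by
  have key : ∀ s ∈ S ∪ S⁻¹, ∀ t ∈ commPairs (ballSet S n) (ballSet S n),
      MulAut.conj s t ∈ commPairs (ballSet S n) (ballSet S n) := by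
    rintro s hs _ ⟨a, ha, b, hb, rfl⟩
    exact h ⟨_, conj_mem_ballSet hs ha, _, conj_mem_ballSet hs hb, by
      simp only [MulAut.conj_apply, commutatorElement_def]; group⟩
  have hx : x ∈ Subgroup.closure S := hgen ▸ Subgroup.mem_top x
  clear h
  induction hx using Subgroup.closure_induction generalizing t with
  | mem s hs =>
    refine ⟨fun ht => ?_, key s (Or.inl hs) t⟩
    simpa [mul_assoc] using key s⁻¹ (Or.inr (Set.inv_mem_inv.2 hs)) _ ht
  | one => simp
  | mul x y _ _ hx hy =>
    rw [map_mul, MulAut.mul_apply]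
    exact (hx _).trans (hy t)
  | inv x _ hx =>
    have := hx (MulAut.conj x⁻¹ t)
    rw [map_inv, MulAut.apply_inv_self] at this
    rw [map_inv]
    exact this.symm

/-- The centralizer of a finite conjugation-invariant set has finite index. -/
lemma finiteIndex_centralizer_of_conj_invariant {T : Set G} (hT : T.Finite)
    (h : ∀ x t : G, MulAut.conj x t ∈ T ↔ t ∈ T) : (Subgroup.centralizer T).FiniteIndex := by
  have := hT.to_subtype
  let φ : G →* Equiv.Perm T :=
    { toFun x := Equiv.Perm.subtypePerm (MulAut.conj x).toEquiv (h x)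
      map_one' := by ext; simp
      map_mul' x y := by
        ext t
        exact DFunLike.congr_fun (map_mul MulAut.conj x y) (t : G) }
  refine Subgroup.finiteIndex_of_le (H := φ.ker) fun x hx => ?_
  rw [Subgroup.mem_centralizer_iff]
  intro t ht
  have hxt : x * t * x⁻¹ = t :=
    congrArg Subtype.val (DFunLike.congr_fun (MonoidHom.mem_ker.1 hx) (⟨t, ht⟩ : T))
  exact (mul_inv_eq_iff_eq_mul.1 hxt).symm

/-- A normal subgroup containing the commutators of generators contains the derived subgroup. -/
lemma commutator_le_of_generators {S : Set G} (hgen : Subgroup.closure S = ⊤)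
    {N : Subgroup G} [N.Normal] (h : ∀ s ∈ S, ∀ t ∈ S, ⁅s, t⁆ ∈ N) : commutator G ≤ N := by
  rw [commutator_def, Subgroup.commutator_le]
  rintro x - y -
  have hx : x ∈ Subgroup.closure S := hgen ▸ Subgroup.mem_top x
  have hy : y ∈ Subgroup.closure S := hgen ▸ Subgroup.mem_top y
  have hiff : ∀ a b : G, ⁅a, b⁆ ∈ N ↔ Commute (a : G ⧸ N) b := fun a b => by
    rw [← QuotientGroup.eq_one_iff, ← commutatorElement_eq_one_iff_commute]
    rfl
  rw [hiff]
  induction hx, hy using Subgroup.closure_induction₂ with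
  | mem s t hs ht => exact (hiff s t).1 (h s hs t ht)
  | one_left => exact Commute.one_left _
  | one_right => exact Commute.one_right _
  | mul_left _ _ _ _ _ _ h₁ h₂ => exact h₁.mul_left h₂
  | mul_right _ _ _ _ _ _ h₁ h₂ => exact h₁.mul_right h₂
  | inv_left _ _ _ _ h => exact h.inv_left
  | inv_right _ _ _ _ h => exact h.inv_right

lemma exists_finiteIndex_of_commPairs_subset {S : Set G} (hS : S.Finite)
    (hgen : Subgroup.closure S = ⊤) {n : ℕ} (hn : 1 ≤ n)
    (h : commPairs (ballSet S (n + 2)) (ballSet S (n + 2)) ⊆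
      commPairs (ballSet S n) (ballSet S n)) :
    ∃ H : Subgroup G, H.FiniteIndex ∧ ⁅H, ⁅H, H⁆⁆ = ⊥ := by
  set T := commPairs (ballSet S n) (ballSet S n)
  have hconj : ∀ x t : G, MulAut.conj x t ∈ T ↔ t ∈ T := conj_mem_commPairs_iff hgen h
  refine ⟨Subgroup.centralizer T, finiteIndex_centralizer_of_conj_invariant
    (finite_commPairs (finite_ballSet hS n) (finite_ballSet hS n)) hconj, ?_⟩
  have hT : Group.conjugatesOfSet T ⊆ T := by
    intro z hz
    obtain ⟨t, ht, hc⟩ := Group.mem_conjugatesOfSet_iff.1 hz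
    obtain ⟨c, rfl⟩ := isConj_iff.1 hc
    exact (hconj c t).2 ht
  have hcomm : commutator G ≤ Subgroup.closure T :=
    (commutator_le_of_generators (N := Subgroup.normalClosure T) hgen fun s hs t ht =>
      Subgroup.subset_normalClosure
        ⟨s, subset_ballSet S hn hs, t, subset_ballSet S hn ht, rfl⟩).trans
      (Subgroup.closure_mono hT)
  rw [Subgroup.commutator_eq_bot_iff_le_centralizer, ← Subgroup.centralizer_closure T]
  exact Subgroup.centralizer_le
    ((Subgroup.commutator_mono le_top le_top).trans hcomm)

end

/-- Let `G` be a group with finite generating set `S`, containing no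
finite-index subgroup that is nilpotent of class at most 2. Then
`|C(S^{≤n}, S^{≤n})| ≥ n/2` for every `n ≥ 1`. -/
theorem statement19 {G : Type*} [Group G] (S : Finset G)
    (hgen : Subgroup.closure (S : Set G) = ⊤)
    (h : ¬ ∃ H : Subgroup G, H.FiniteIndex ∧ ⁅H, ⁅H, H⁆⁆ = ⊥) :
    ∀ n : ℕ, 1 ≤ n →
      (n : ℝ) / 2 ≤
        ((commPairs (ballSet (S : Set G) n) (ballSet (S : Set G) n)).ncard : ℝ) := by
  have hS := S.finite_toSet
  have hfin : ∀ n, (commPairs (ballSet (S : Set G) n) (ballSet (S : Set G) n)).Finite :=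
    fun n => finite_commPairs (finite_ballSet hS n) (finite_ballSet hS n)
  intro n hn
  suffices H : ∀ n, 1 ≤ n →
      n ≤ 2 * (commPairs (ballSet (S : Set G) n) (ballSet (S : Set G) n)).ncard by
    have := (Nat.cast_le (α := ℝ)).2 (H n hn)
    push_cast at this
    linarith
  clear n hn
  intro n
  induction n using Nat.twoStepInduction with
  | zero => simp
  | one =>
    intro _
    have : 0 < (commPairs (ballSet (S : Set G) 1) (ballSet (S : Set G) 1)).ncard :=
      (Set.ncard_pos (hfin 1)).2
        ⟨_, 1, by simp [ballSet], 1, by simp [ballSet], rfl⟩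
    lia
  | more n ih _ =>
    intro _
    have hmono := commPairs_mono (ballSet_mono (S : Set G) (Nat.le_add_right n 2))
    rcases Nat.eq_zero_or_pos n with rfl | hn
    · have : 0 < (commPairs (ballSet (S : Set G) 2) (ballSet (S : Set G) 2)).ncard :=
        (Set.ncard_pos (hfin 2)).2 ⟨_, 1, Set.one_mem_pow (one_mem_symm _), 1,
          Set.one_mem_pow (one_mem_symm _), rfl⟩
      lia
    · have := Set.ncard_lt_ncard (⟨hmono, fun hsub =>
        h (exists_finiteIndex_of_commPairs_subset hS hgen hn hsub)⟩) (hfin (n + 2))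
      have := ih hn
      lia
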